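/- Suppose the two-sided hedonic equilibrium condition holds, that Ū, ζ and C are twice continuously differentiable, that there is a constant M₁ with D²_{zz}(U(ε,z) − C(ỹ,z)) ≤ M₁·Id as quadratic forms, that μ_ε is absolutely continuous with respect to Lebesgue measure, that ε ↦ ∇_zζ(ε,z) is injective for each z (Twist condition), that z ↦ ∇_εζ(ε,z) is injective on Z for each ε, that ‖∇_zζ(ε,z)‖ → ∞ as ‖ε‖ → ∞ uniformly in z ∈ Z, and that D²_{εz}ζ(ε,z) is invertible with uniformly bounded inverse. Then, without any ζ-convexity assumption on the potential, the marginal utility is nonparametrically identified: if Ū' is any continuously differentiable function on Z compatible with the data (μ_ε, μ_z, p), then ∇Ū'(z) = ∇Ū(z) for μ_z-almost every z; moreover V = p − Ū coincides μ_z-almost everywhere with a ζ-convex function. -/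

import Mathlib

open MeasureTheory Set

/-- ζ-conjugate of `W : Z → ℝ`: `W^ζ(ε) = sup_{z ∈ Z} (ζ(ε,z) - W z)`. -/
noncomputable def zetaConj {d : ℕ} (Z : Set (EuclideanSpace ℝ (Fin d)))
    (ζ : EuclideanSpace ℝ (Fin d) → EuclideanSpace ℝ (Fin d) → ℝ)
    (W : EuclideanSpace ℝ (Fin d) → ℝ) (ε : EuclideanSpace ℝ (Fin d)) : ℝ :=
  sSup ((fun z => ζ ε z - W z) '' Z)

/-- ζ-double-conjugate: `W^{ζζ}(z) = sup_{ε ∈ ℝ^d} (ζ(ε,z) - W^ζ(ε))`. -/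
noncomputable def zetaConj2 {d : ℕ} (Z : Set (EuclideanSpace ℝ (Fin d)))
    (ζ : EuclideanSpace ℝ (Fin d) → EuclideanSpace ℝ (Fin d) → ℝ)
    (W : EuclideanSpace ℝ (Fin d) → ℝ) (z : EuclideanSpace ℝ (Fin d)) : ℝ :=
  ⨆ ε : EuclideanSpace ℝ (Fin d), (ζ ε z - zetaConj Z ζ W ε)

/-- A function `W : Z → ℝ` is ζ-convex if it agrees with its ζ-double-conjugate on `Z`. -/
def ZetaConvexOn {d : ℕ} (Z : Set (EuclideanSpace ℝ (Fin d)))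
    (ζ : EuclideanSpace ℝ (Fin d) → EuclideanSpace ℝ (Fin d) → ℝ)
    (W : EuclideanSpace ℝ (Fin d) → ℝ) : Prop :=
  ∀ z ∈ Z, W z = zetaConj2 Z ζ W z

/-- A candidate deterministic utility `W` is *compatible* with the single-market data
`(με, μz, price)` for the surplus `ζ`. -/
def CompatibleZ {d : ℕ} (Z : Set (EuclideanSpace ℝ (Fin d)))
    (ζ : EuclideanSpace ℝ (Fin d) → EuclideanSpace ℝ (Fin d) → ℝ)
    (price : EuclideanSpace ℝ (Fin d) → ℝ)
    (με μz : Measure (EuclideanSpace ℝ (Fin d)))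
    (W : EuclideanSpace ℝ (Fin d) → ℝ) : Prop :=
  ∃ γ : Measure (EuclideanSpace ℝ (Fin d) × EuclideanSpace ℝ (Fin d)),
    IsProbabilityMeasure γ ∧
    γ.map Prod.fst = με ∧ γ.map Prod.snd = μz ∧
    ∀ᵐ q ∂γ, q.2 ∈ interior Z ∧
      IsMaxOn (fun z' => W z' + ζ q.1 z' - price z') Z q.2

/-- For a finite inner regular measure, almost-everywhere statements pass to the image under a
continuous map, without any measurability of the predicate. -/
theorem ae_map_of_ae_of_continuous {X Y : Type*} [TopologicalSpace X] [T2Space X]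
    [MeasurableSpace X] [BorelSpace X] [TopologicalSpace Y] [T2Space Y] [MeasurableSpace Y]
    [BorelSpace Y] {μ : Measure X} [IsFiniteMeasure μ] [μ.InnerRegularCompactLTTop]
    {f : X → Y} (hf : Continuous f) {p : Y → Prop} (h : ∀ᵐ x ∂μ, p (f x)) :
    ∀ᵐ y ∂μ.map f, p y := by
  obtain ⟨s, hs, hsm, hs0⟩ := exists_measurable_superset_of_null (ae_iff.1 h)
  refine ae_iff.2 (nonpos_iff_eq_zero.1 (le_of_forall_pos_le_add fun ε hε => ?_))
  obtain ⟨K, hKs, hK, hKε⟩ :=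
    hsm.compl.exists_isCompact_sdiff_lt (measure_ne_top μ _) hε.ne'
  calc μ.map f {y | ¬p y} ≤ μ.map f (f '' K)ᶜ := by
        refine measure_mono ?_
        rintro _ hy ⟨x, hx, rfl⟩
        exact hKs hx (hs hy)
    _ = μ (f ⁻¹' (f '' K)ᶜ) :=
        Measure.map_apply hf.measurable (hK.image hf).measurableSet.compl
    _ ≤ μ (s ∪ (sᶜ \ K)) := by
        refine measure_mono fun x hx => ?_
        by_cases hxs : x ∈ s
        · exact Or.inl hxs
        · exact Or.inr ⟨hxs, fun hxK => hx (mem_image_of_mem f hxK)⟩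
    _ ≤ 0 + ε := (measure_union_le _ _).trans (add_le_add hs0.le hKε.le)

/-- Two couplings of the same marginals: if `f ⊕ g ≤ 0` along the first and `f ⊕ g ≥ 0` along the
second, then `f ⊕ g = 0` along the first. -/
theorem ae_add_eq_zero_of_map_eq {Ω Ω' A B : Type*} [MeasurableSpace Ω] [MeasurableSpace Ω']
    [MeasurableSpace A] [MeasurableSpace B] {P : Measure Ω} {P' : Measure Ω'}
    [IsFiniteMeasure P] [IsFiniteMeasure P'] {X : Ω → A} {T : Ω → B} {X' : Ω' → A} {T' : Ω' → B}
    (hX : Measurable X) (hT : Measurable T) (hX' : Measurable X') (hT' : Measurable T')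
    (hXX' : P.map X = P'.map X') (hTT' : P.map T = P'.map T')
    {f : A → ℝ} {g : B → ℝ} (hf : Measurable f) (hg : Measurable g) {c : ℝ}
    (hfc : ∀ a, |f a| ≤ c) (hgc : ∀ b, |g b| ≤ c)
    (hle : ∀ᵐ ω ∂P, f (X ω) + g (T ω) ≤ 0) (hge : ∀ᵐ ω ∂P', 0 ≤ f (X' ω) + g (T' ω)) :
    ∀ᵐ ω ∂P, f (X ω) + g (T ω) = 0 := by
  have hfX : Integrable (fun ω => f (X ω)) P :=
    .of_bound (hf.comp hX).aestronglyMeasurable c (.of_forall fun _ => hfc _)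
  have hgT : Integrable (fun ω => g (T ω)) P :=
    .of_bound (hg.comp hT).aestronglyMeasurable c (.of_forall fun _ => hgc _)
  have hfX' : Integrable (fun ω => f (X' ω)) P' :=
    .of_bound (hf.comp hX').aestronglyMeasurable c (.of_forall fun _ => hfc _)
  have hgT' : Integrable (fun ω => g (T' ω)) P' :=
    .of_bound (hg.comp hT').aestronglyMeasurable c (.of_forall fun _ => hgc _)
  have heq : ∫ ω, (f (X ω) + g (T ω)) ∂P = ∫ ω, (f (X' ω) + g (T' ω)) ∂P' := by
    rw [integral_add hfX hgT, integral_add hfX' hgT',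
      ← integral_map hX.aemeasurable hf.aestronglyMeasurable,
      ← integral_map hT.aemeasurable hg.aestronglyMeasurable, hXX', hTT',
      integral_map hX'.aemeasurable hf.aestronglyMeasurable,
      integral_map hT'.aemeasurable hg.aestronglyMeasurable]
  have h0 : ∫ ω, -(f (X ω) + g (T ω)) ∂P = 0 := by
    rw [integral_neg]
    have h1 := integral_nonneg_of_ae hge
    have h2 := integral_nonpos_of_ae hle
    linarith
  have h := (integral_eq_zero_iff_of_nonneg_ae
    (hle.mono fun ω hω => neg_nonneg.2 hω) (hfX.add hgT).neg).1 h0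
  filter_upwards [h] with ω hω
  exact neg_eq_zero.1 hω

section Conjugate

variable {d : ℕ} {Z : Set (EuclideanSpace ℝ (Fin d))}
  {ζ : EuclideanSpace ℝ (Fin d) → EuclideanSpace ℝ (Fin d) → ℝ}
  {W W' : EuclideanSpace ℝ (Fin d) → ℝ}

theorem bddAbove_image_sub (hZ : IsCompact Z) (hζ : ∀ ε, Continuous (ζ ε))
    (hW : BddBelow (W '' Z)) (ε : EuclideanSpace ℝ (Fin d)) :
    BddAbove ((fun z => ζ ε z - W z) '' Z) := by
  obtain ⟨b, hb⟩ := hW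
  obtain ⟨a, ha⟩ := hZ.bddAbove_image (hζ ε).continuousOn
  refine ⟨a - b, ?_⟩
  rintro _ ⟨z, hz, rfl⟩
  have h1 := ha (mem_image_of_mem _ hz)
  have h2 := hb (mem_image_of_mem _ hz)
  simp only
  linarith

theorem bddBelow_image_of_isMaxOn (hZ : IsCompact Z) (hζ : ∀ ε, Continuous (ζ ε))
    {ε z : EuclideanSpace ℝ (Fin d)} (h : IsMaxOn (fun z' => ζ ε z' - W z') Z z) :
    BddBelow (W '' Z) := by
  obtain ⟨a, ha⟩ := hZ.bddBelow_image (hζ ε).continuousOn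
  refine ⟨a - (ζ ε z - W z), ?_⟩
  rintro _ ⟨z', hz', rfl⟩
  have h1 := ha (mem_image_of_mem _ hz')
  have h2 := isMaxOn_iff.1 h z' hz'
  linarith

theorem zetaConj_eq_of_isMaxOn {ε z : EuclideanSpace ℝ (Fin d)} (hz : z ∈ Z)
    (h : IsMaxOn (fun z' => ζ ε z' - W z') Z z) : zetaConj Z ζ W ε = ζ ε z - W z := by
  refine IsGreatest.csSup_eq ⟨mem_image_of_mem _ hz, ?_⟩
  rintro _ ⟨z', hz', rfl⟩
  exact isMaxOn_iff.1 h z' hz'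

theorem sub_le_zetaConj (hZ : IsCompact Z) (hζ : ∀ ε, Continuous (ζ ε))
    (hW : BddBelow (W '' Z)) (ε : EuclideanSpace ℝ (Fin d)) {z : EuclideanSpace ℝ (Fin d)}
    (hz : z ∈ Z) : ζ ε z - W z ≤ zetaConj Z ζ W ε :=
  le_csSup (bddAbove_image_sub hZ hζ hW ε) (mem_image_of_mem _ hz)

theorem zetaConj_le_zetaConj_add (hZ : IsCompact Z) (hne : Z.Nonempty)
    (hζ : ∀ ε, Continuous (ζ ε)) (hW' : BddBelow (W' '' Z)) {c : ℝ}
    (hc : ∀ z ∈ Z, W' z ≤ W z + c) (ε : EuclideanSpace ℝ (Fin d)) :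
    zetaConj Z ζ W ε ≤ zetaConj Z ζ W' ε + c := by
  refine csSup_le (hne.image _) ?_
  rintro _ ⟨z, hz, rfl⟩
  have h1 := sub_le_zetaConj hZ hζ hW' ε hz
  have h2 := hc z hz
  simp only
  linarith

theorem measurable_zetaConj (hZ : IsCompact Z)
    (hζ : Continuous fun q : EuclideanSpace ℝ (Fin d) × EuclideanSpace ℝ (Fin d) => ζ q.1 q.2)
    (hW : BddBelow (W '' Z)) : Measurable (zetaConj Z ζ W) := by
  have h : LowerSemicontinuous fun ε => ⨆ z : Z, (ζ ε z - W z) := by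
    refine lowerSemicontinuous_ciSup (fun ε => ?_) fun z => ?_
    · have := bddAbove_image_sub hZ (fun ε => hζ.comp (by fun_prop : Continuous fun z => (ε, z)))
        hW ε
      rwa [image_eq_range] at this
    · have : Continuous fun ε => ζ ε z := hζ.comp (continuous_id.prodMk continuous_const)
      exact (this.sub continuous_const).lowerSemicontinuous
  convert h.measurable using 2 with ε
  exact sSup_image' ..

theorem bddAbove_range_sub_zetaConj (hZ : IsCompact Z) (hζ : ∀ ε, Continuous (ζ ε))
    (hW : BddBelow (W '' Z)) {z : EuclideanSpace ℝ (Fin d)} (hz : z ∈ Z) :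
    BddAbove (range fun ε => ζ ε z - zetaConj Z ζ W ε) := by
  refine ⟨W z, ?_⟩
  rintro _ ⟨ε, rfl⟩
  have := sub_le_zetaConj hZ hζ hW ε hz
  simp only
  linarith

theorem sub_zetaConj_le_zetaConj2 (hZ : IsCompact Z) (hζ : ∀ ε, Continuous (ζ ε))
    (hW : BddBelow (W '' Z)) (ε : EuclideanSpace ℝ (Fin d)) {z : EuclideanSpace ℝ (Fin d)}
    (hz : z ∈ Z) : ζ ε z - zetaConj Z ζ W ε ≤ zetaConj2 Z ζ W z :=
  le_ciSup (bddAbove_range_sub_zetaConj hZ hζ hW hz) ε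

theorem zetaConj2_le (hZ : IsCompact Z) (hζ : ∀ ε, Continuous (ζ ε))
    (hW : BddBelow (W '' Z)) {z : EuclideanSpace ℝ (Fin d)} (hz : z ∈ Z) :
    zetaConj2 Z ζ W z ≤ W z :=
  ciSup_le fun ε => by
    have := sub_le_zetaConj hZ hζ hW ε hz
    linarith

theorem zetaConj_zetaConj2 (hZ : IsCompact Z) (hne : Z.Nonempty) (hζ : ∀ ε, Continuous (ζ ε))
    (hW : BddBelow (W '' Z)) : zetaConj Z ζ (zetaConj2 Z ζ W) = zetaConj Z ζ W := by
  funext ε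
  have hub : ∀ z ∈ Z, ζ ε z - zetaConj2 Z ζ W z ≤ zetaConj Z ζ W ε := fun z hz => by
    have := sub_zetaConj_le_zetaConj2 hZ hζ hW ε hz
    linarith
  refine le_antisymm (csSup_le (hne.image _) (forall_mem_image.2 hub))
    (csSup_le (hne.image _) (forall_mem_image.2 fun z hz => ?_))
  have h1 := zetaConj2_le hZ hζ hW hz
  have h2 : ζ ε z - zetaConj2 Z ζ W z ≤ zetaConj Z ζ (zetaConj2 Z ζ W) ε :=
    le_csSup ⟨_, forall_mem_image.2 hub⟩ (mem_image_of_mem _ hz)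
  linarith

theorem zetaConvexOn_zetaConj2 (hZ : IsCompact Z) (hne : Z.Nonempty)
    (hζ : ∀ ε, Continuous (ζ ε)) (hW : BddBelow (W '' Z)) :
    ZetaConvexOn Z ζ (zetaConj2 Z ζ W) := fun z _ => by
  rw [zetaConj2, zetaConj2, zetaConj_zetaConj2 hZ hne hζ hW]

theorem eq_zetaConj2_of_isMaxOn (hZ : IsCompact Z) (hζ : ∀ ε, Continuous (ζ ε))
    {ε z : EuclideanSpace ℝ (Fin d)} (hz : z ∈ Z)
    (h : IsMaxOn (fun z' => ζ ε z' - W z') Z z) : W z = zetaConj2 Z ζ W z := by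
  have hW := bddBelow_image_of_isMaxOn hZ hζ h
  refine le_antisymm ?_ (zetaConj2_le hZ hζ hW hz)
  have := sub_zetaConj_le_zetaConj2 hZ hζ hW ε hz
  rw [zetaConj_eq_of_isMaxOn hz h] at this
  linarith

end Conjugate

/-- identification under primitive restrictions only; general surplus.
Under the two-sided hedonic equilibrium condition and the primitive regularity, Twist,
coercivity and nondegeneracy conditions of the text, no ζ-convexity restriction on the
potential is needed: any continuously differentiable `Ubar'` compatible with the data
satisfies `∇Ubar' = ∇Ubar` `μz`-almost everywhere; moreover the potential `price - Ubar`
coincides `μz`-almost everywhere with a ζ-convex function. -/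
theorem stmt_11 {d m : ℕ}
    (Z : Set (EuclideanSpace ℝ (Fin d))) (hZc : IsCompact Z) (hZi : (interior Z).Nonempty)
    (Y : Set (EuclideanSpace ℝ (Fin m))) (hYc : IsCompact Y)
    (Ubar : EuclideanSpace ℝ (Fin d) → ℝ)
    (ζ : EuclideanSpace ℝ (Fin d) → EuclideanSpace ℝ (Fin d) → ℝ)
    (C : EuclideanSpace ℝ (Fin m) → EuclideanSpace ℝ (Fin d) → ℝ)
    (price : EuclideanSpace ℝ (Fin d) → ℝ)
    (hU : ContDiff ℝ 2 Ubar)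
    (hζ : ContDiff ℝ 2 (fun q : EuclideanSpace ℝ (Fin d) × EuclideanSpace ℝ (Fin d) => ζ q.1 q.2))
    (hC : ContDiff ℝ 2 (fun q : EuclideanSpace ℝ (Fin m) × EuclideanSpace ℝ (Fin d) => C q.1 q.2))
    (M₁ : ℝ)
    (hHess : ∀ (ε : EuclideanSpace ℝ (Fin d)) (y : EuclideanSpace ℝ (Fin m))
      (z v : EuclideanSpace ℝ (Fin d)),
      ((fderiv ℝ (fderiv ℝ (fun w => (Ubar w + ζ ε w) - C y w)) z) v) v ≤ M₁ * ‖v‖ ^ 2)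
    (με : Measure (EuclideanSpace ℝ (Fin d))) [IsProbabilityMeasure με]
    (μy : Measure (EuclideanSpace ℝ (Fin m))) [IsProbabilityMeasure μy]
    (hac : με ≪ volume) (hμy : ∀ᵐ y ∂μy, y ∈ Y)
    -- Twist condition: `ε ↦ ∇_zζ(ε,z)` is injective for each `z`.
    (htwist : ∀ z : EuclideanSpace ℝ (Fin d),
      Function.Injective fun ε => fderiv ℝ (ζ ε) z)
    -- `z ↦ ∇_εζ(ε,z)` is injective on `Z` for each `ε`.
    (htwist' : ∀ ε : EuclideanSpace ℝ (Fin d),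
      Set.InjOn (fun z => fderiv ℝ (fun e => ζ e z) ε) Z)
    -- coercivity: `‖∇_zζ(ε,z)‖ → ∞` as `‖ε‖ → ∞`, uniformly in `z ∈ Z`.
    (hcoerc : ∀ M : ℝ, ∃ R : ℝ, ∀ ε : EuclideanSpace ℝ (Fin d), R ≤ ‖ε‖ →
      ∀ z ∈ Z, M ≤ ‖fderiv ℝ (ζ ε) z‖)
    (M₀ : ℝ)
    -- `D²_{εz}ζ(ε,z)` is invertible with inverse uniformly bounded by `M₀`.
    (hmix : ∀ (ε z : EuclideanSpace ℝ (Fin d)),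
      ∃ A : (EuclideanSpace ℝ (Fin d) →L[ℝ] ℝ) →L[ℝ] EuclideanSpace ℝ (Fin d),
        (∀ v, A ((fderiv ℝ (fun e => fderiv ℝ (ζ e) z) ε) v) = v) ∧
        (∀ w, (fderiv ℝ (fun e => fderiv ℝ (ζ e) z) ε) (A w) = w) ∧ ‖A‖ ≤ M₀)
    (γ : Measure (EuclideanSpace ℝ (Fin d) × EuclideanSpace ℝ (Fin d) × EuclideanSpace ℝ (Fin m)))
    (hγ : IsProbabilityMeasure γ)
    (hγε : γ.map (fun q => q.1) = με)
    (hγy : γ.map (fun q => q.2.2) = μy)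
    (heqm : ∀ᵐ q ∂γ, q.2.1 ∈ interior Z ∧
      IsMaxOn (fun z' => (Ubar z' + ζ q.1 z') - price z') Z q.2.1 ∧
      IsMaxOn (fun z' => price z' - C q.2.2 z') Z q.2.1)
    (hsel : ∃ sel : EuclideanSpace ℝ (Fin d) × EuclideanSpace ℝ (Fin m) → EuclideanSpace ℝ (Fin d),
      Measurable sel ∧ ∀ ε y, sel (ε, y) ∈ Z ∧
        IsMaxOn (fun z => (Ubar z + ζ ε z) - C y z) Z (sel (ε, y))) :
    (∀ Ubar' : EuclideanSpace ℝ (Fin d) → ℝ, ContDiffOn ℝ 1 Ubar' Z →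
      CompatibleZ Z ζ price με (γ.map (fun q => q.2.1)) Ubar' →
      ∀ᵐ z ∂(γ.map (fun q => q.2.1)), fderiv ℝ Ubar' z = fderiv ℝ Ubar z) ∧
    (∃ W : EuclideanSpace ℝ (Fin d) → ℝ, ZetaConvexOn Z ζ W ∧
      ∀ᵐ z ∂(γ.map (fun q => q.2.1)), price z - Ubar z = W z) := by
  have hζc : ∀ ε, Continuous (ζ ε) := fun ε =>
    hζ.continuous.comp (by fun_prop : Continuous fun z => (ε, z))
  have hne : Z.Nonempty := hZi.mono interior_subset
  have hV : ∀ᵐ q ∂γ, IsMaxOn (fun z' => ζ q.1 z' - (price z' - Ubar z')) Z q.2.1 :=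
    heqm.mono fun q hq => by
      convert hq.2.1 using 2
      ring
  have hVb : BddBelow ((fun z => price z - Ubar z) '' Z) := by
    obtain ⟨q, hq⟩ := hV.exists
    exact bddBelow_image_of_isMaxOn hZc hζc hq
  refine ⟨fun Ubar' hU' hcomp => ?_, zetaConj2 Z ζ fun z => price z - Ubar z,
    zetaConvexOn_zetaConj2 hZc hne hζc hVb, ?_⟩
  · obtain ⟨γ', hγ', hγ'ε, hγ'z, hmax'⟩ := hcomp
    obtain ⟨c, hc⟩ := hZc.exists_bound_of_continuousOn
      (hU'.continuousOn.sub hU.continuous.continuousOn)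
    have hc0 : 0 ≤ c := (norm_nonneg _).trans (hc _ hne.some_mem)
    replace hc : ∀ z ∈ Z, |Ubar' z - Ubar z| ≤ c := hc
    have hV'b : BddBelow ((fun z => price z - Ubar' z) '' Z) := by
      obtain ⟨b, hb⟩ := hVb
      refine ⟨b - c, forall_mem_image.2 fun z hz => ?_⟩
      have h1 := hb (mem_image_of_mem _ hz)
      have h2 := abs_le.1 (hc z hz)
      linarith
    have hV' : ∀ᵐ q ∂γ', IsMaxOn (fun z' => ζ q.1 z' - (price z' - Ubar' z')) Z q.2 :=
      hmax'.mono fun q hq => by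
        convert hq.2 using 2
        ring
    classical
    have hzero := ae_add_eq_zero_of_map_eq (P := γ) (P' := γ') (X := fun q => q.1)
      (T := fun q => q.2.1) (X' := Prod.fst) (T' := Prod.snd)
      (by fun_prop) (by fun_prop) (by fun_prop) (by fun_prop)
      (hγε.trans hγ'ε.symm) hγ'z.symm
      (f := fun ε => zetaConj Z ζ (fun z => price z - Ubar z) ε
        - zetaConj Z ζ (fun z => price z - Ubar' z) ε)
      (g := Z.piecewise (Ubar' - Ubar) 0) (c := c)
      ((measurable_zetaConj hZc hζ.continuous hVb).sub
        (measurable_zetaConj hZc hζ.continuous hV'b))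
      (ContinuousOn.measurable_piecewise
        (hU'.continuousOn.sub hU.continuous.continuousOn) continuousOn_const hZc.measurableSet)
      (fun ε => ?_) (fun z => ?_) ?_ ?_
    · refine (ae_map_iff (by fun_prop) (measurableSet_eq_fun (measurable_fderiv ℝ _)
        (measurable_fderiv ℝ _))).2 ?_
      filter_upwards [heqm, hV, hzero] with q hq hVq h0
      have hqZ : q.2.1 ∈ Z := interior_subset hq.1
      have hnhds : Z ∈ nhds q.2.1 := mem_interior_iff_mem_nhds.1 hq.1
      have hV'q : IsMaxOn (fun z' => ζ q.1 z' - (price z' - Ubar' z')) Z q.2.1 := by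
        refine isMaxOn_iff.2 fun z hz => ?_
        have h1 := sub_le_zetaConj hZc hζc hV'b q.1 hz
        rw [zetaConj_eq_of_isMaxOn hqZ hVq, piecewise_eq_of_mem _ _ _ hqZ] at h0
        simp only [Pi.sub_apply] at h0
        linarith
      have hCd : DifferentiableAt ℝ (C q.2.2) q.2.1 :=
        ((hC.comp (by fun_prop : ContDiff ℝ 2 fun z => (q.2.2, z))).differentiable
          two_ne_zero).differentiableAt
      have hζd : DifferentiableAt ℝ (ζ q.1) q.2.1 :=
        ((hζ.comp (by fun_prop : ContDiff ℝ 2 fun z => (q.1, z))).differentiable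
          two_ne_zero).differentiableAt
      -- Adding the producer's optimality removes the price from the first-order condition.
      have key : ∀ u : EuclideanSpace ℝ (Fin d) → ℝ, DifferentiableAt ℝ u q.2.1 →
          IsMaxOn (fun z' => ζ q.1 z' - (price z' - u z')) Z q.2.1 →
          fderiv ℝ u q.2.1 = fderiv ℝ (C q.2.2) q.2.1 - fderiv ℝ (ζ q.1) q.2.1 := by
        intro u hu hmax
        have hloc : IsLocalMax (u + ζ q.1 - C q.2.2) q.2.1 := by
          refine IsMaxOn.isLocalMax (isMaxOn_iff.2 fun z hz => ?_) hnhds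
          have h1 := isMaxOn_iff.1 hmax z hz
          have h2 := isMaxOn_iff.1 hq.2.2 z hz
          simp only [Pi.sub_apply, Pi.add_apply]
          linarith
        have h := hloc.fderiv_eq_zero
        rw [fderiv_sub (hu.add hζd) hCd, fderiv_add hu hζd, sub_eq_zero] at h
        rw [← h, add_sub_cancel_right]
      rw [key Ubar' ((hU'.contDiffAt hnhds).differentiableAt one_ne_zero) hV'q,
        key Ubar (hU.differentiable two_ne_zero).differentiableAt hVq]
    · have h1 := zetaConj_le_zetaConj_add (W := fun z => price z - Ubar z) hZc hne hζc hV'b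
        (c := c) (fun z hz => by have := abs_le.1 (hc z hz); linarith) ε
      have h2 := zetaConj_le_zetaConj_add (W := fun z => price z - Ubar' z) hZc hne hζc hVb
        (c := c) (fun z hz => by have := abs_le.1 (hc z hz); linarith) ε
      exact abs_le.2 ⟨by linarith, by linarith⟩
    · by_cases hz : z ∈ Z
      · simpa [hz] using hc z hz
      · simpa [hz] using hc0
    · filter_upwards [heqm, hV] with q hq hVq
      have hqZ : q.2.1 ∈ Z := interior_subset hq.1
      have h1 := sub_le_zetaConj hZc hζc hV'b q.1 hqZ
      rw [zetaConj_eq_of_isMaxOn hqZ hVq, piecewise_eq_of_mem _ _ _ hqZ, Pi.sub_apply]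
      linarith
    · filter_upwards [hmax', hV'] with q hq hVq
      have hqZ : q.2 ∈ Z := interior_subset hq.1
      have h1 := sub_le_zetaConj hZc hζc hVb q.1 hqZ
      rw [zetaConj_eq_of_isMaxOn hqZ hVq, piecewise_eq_of_mem _ _ _ hqZ, Pi.sub_apply]
      linarith
  · refine ae_map_of_ae_of_continuous (by fun_prop) ?_
    filter_upwards [heqm, hV] with q hq hVq
    exact eq_zetaConj2_of_isMaxOn (W := fun z => price z - Ubar z) hZc hζc
      (interior_subset hq.1) hVq
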